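/- arXiv:2402.07823 — 3 statements merged into one kernel-verified Lean document; each statement's English description precedes it below -/
import Mathlib

section
/- For every L ≥ 1, let N = 2^L and define the logical-X support vectors x_1,…,x_{2^{L−1}} over GF(2) by: x_i is row i of H_L if L is odd, and x_i is row i of H_L with its coordinates permuted by P_L if L is even. Then the minimum, over all nonempty subsets S of {1,…,2^{L−1}}, of the Hamming weight wt(∑_{i∈S} x_i) equals log₂(N) + 1 = L + 1 if L is odd, and equals log₂(N) = L if L is even (with L ≥ 2 in the even case). -/
/-- The permutation `P_{M+1}` (paper index `M+1`) of the `2^(M+1)` columns,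
exchanging the two members of each consecutive pair (0-indexed: `2k ↔ 2k+1`). -/
def pairSwap (M : ℕ) : Fin (2 ^ (M + 1)) → Fin (2 ^ (M + 1)) := fun c =>
  if _h : c.val % 2 = 0 then
    ⟨c.val + 1, by
      have hc := c.isLt
      have h2 : (2:ℕ) ^ (M + 1) = 2 * 2 ^ M := by ring
      omega⟩
  else
    ⟨c.val - 1, by have hc := c.isLt; omega⟩

/-- `Hmat L` is the parity-check matrix `H_{L+1}` of the paper (paper index shifted by one),
a `2^L × 2^(L+1)` matrix over GF(2), defined recursively.  Rows and columns are 0-indexed: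
0-indexed row `r` is paper row `r+1`, 0-indexed column `c` is paper column `c+1`. -/
def Hmat : (L : ℕ) → Matrix (Fin (2 ^ L)) (Fin (2 ^ (L + 1))) (ZMod 2)
  | 0 => Matrix.of fun _ _ => 1
  | (L + 1) => Matrix.of fun r c =>
    have hr : r.val / 2 < 2 ^ L := by
      have h := r.isLt
      have h2 : (2:ℕ) ^ (L + 1) = 2 * 2 ^ L := by ring
      omega
    have hc : c.val / 2 < 2 ^ (L + 1) := by
      have h := c.isLt
      have h2 : (2:ℕ) ^ (L + 1 + 1) = 2 * 2 ^ (L + 1) := by ring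
      omega
    if c.val % 2 = 1 then (if c.val = 2 * r.val + 1 then 1 else 0)
    else if r.val % 2 = 1 then Hmat L ⟨r.val / 2, hr⟩ (pairSwap L ⟨c.val / 2, hc⟩)
    else Hmat L ⟨r.val / 2, hr⟩ ⟨c.val / 2, hc⟩

/-- The Hamming weight of a vector over GF(2): the number of nonzero coordinates. -/
def hamWt {n : ℕ} (v : Fin n → ZMod 2) : ℕ :=
  (Finset.univ.filter (fun c => v c ≠ 0)).card

/-- The even index `2k`. -/
def evenIdx {n : ℕ} (k : Fin (2 ^ n)) : Fin (2 ^ (n + 1)) :=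
  ⟨2 * k.val, by have := k.isLt; rw [pow_succ]; omega⟩

/-- The odd index `2k + 1`. -/
def oddIdx {n : ℕ} (k : Fin (2 ^ n)) : Fin (2 ^ (n + 1)) :=
  ⟨2 * k.val + 1, by have := k.isLt; rw [pow_succ]; omega⟩

/-- The entries of a vector at even positions. -/
def evenPart {n : ℕ} {R : Type*} (u : Fin (2 ^ (n + 1)) → R) : Fin (2 ^ n) → R :=
  fun k => u (evenIdx k)

/-- The entries of a vector at odd positions. -/
def oddPart {n : ℕ} {R : Type*} (u : Fin (2 ^ (n + 1)) → R) : Fin (2 ^ n) → R :=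
  fun k => u (oddIdx k)

/-- The linear map `u ↦ u A`, where `A` consists of the even columns (0-indexed) of `Hmat n`. -/
def evenColMap (n : ℕ) (u : Fin (2 ^ n) → ZMod 2) : Fin (2 ^ n) → ZMod 2 :=
  evenPart (Matrix.vecMul u (Hmat n))

theorem exists_eq_evenIdx_or_oddIdx {n : ℕ} (c : Fin (2 ^ (n + 1))) :
    ∃ k, c = evenIdx k ∨ c = oddIdx k := by
  have hc := c.isLt
  have h2 : 2 ^ (n + 1) = 2 ^ n * 2 := pow_succ 2 n
  refine ⟨⟨c.val / 2, by omega⟩, ?_⟩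
  simp only [evenIdx, oddIdx, Fin.ext_iff]
  omega

theorem ext_evenPart_oddPart {n : ℕ} {R : Type*} {u v : Fin (2 ^ (n + 1)) → R}
    (he : evenPart u = evenPart v) (ho : oddPart u = oddPart v) : u = v := by
  funext c
  obtain ⟨k, rfl | rfl⟩ := exists_eq_evenIdx_or_oddIdx c
  · exact congrFun he k
  · exact congrFun ho k

theorem sum_evenIdx_add_sum_oddIdx {n : ℕ} {R : Type*} [AddCommMonoid R]
    (f : Fin (2 ^ (n + 1)) → R) :
    ∑ c, f c = ∑ k, f (evenIdx k) + ∑ k, f (oddIdx k) := by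
  rw [← (finProdFinEquiv.trans (finCongr (pow_succ 2 n).symm)).sum_comp f,
    Fintype.sum_prod_type, ← Finset.sum_add_distrib]
  refine Finset.sum_congr rfl fun k _ => ?_
  rw [Fin.sum_univ_two]
  congr 2 <;> simp [evenIdx, oddIdx, Fin.ext_iff, add_comm]

theorem hamWt_eq_sum {n : ℕ} (v : Fin n → ZMod 2) :
    hamWt v = ∑ c, if v c ≠ 0 then 1 else 0 := by
  rw [hamWt, Finset.card_filter]

theorem hamWt_eq_evenPart_add_oddPart {n : ℕ} (v : Fin (2 ^ (n + 1)) → ZMod 2) :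
    hamWt v = hamWt (evenPart v) + hamWt (oddPart v) := by
  simp only [hamWt_eq_sum, sum_evenIdx_add_sum_oddIdx]
  rfl

theorem hamWt_zero {n : ℕ} : hamWt (0 : Fin n → ZMod 2) = 0 := by
  simp [hamWt]

theorem hamWt_pos {n : ℕ} {v : Fin n → ZMod 2} (hv : v ≠ 0) : 0 < hamWt v := by
  obtain ⟨c, hc⟩ := Function.ne_iff.mp hv
  exact Finset.card_pos.mpr ⟨c, by simpa using hc⟩

theorem hamWt_add_le {n : ℕ} (u v : Fin n → ZMod 2) :
    hamWt (u + v) ≤ hamWt u + hamWt v := by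
  simp only [hamWt_eq_sum, ← Finset.sum_add_distrib]
  refine Finset.sum_le_sum fun c _ => ?_
  rw [Pi.add_apply]
  generalize u c = a
  generalize v c = b
  revert a b
  decide

theorem hamWt_comp_equiv {n : ℕ} (e : Fin n ≃ Fin n) (v : Fin n → ZMod 2) :
    hamWt (fun c => v (e c)) = hamWt v := by
  simp only [hamWt_eq_sum]
  exact e.sum_comp fun c => if v c ≠ 0 then 1 else 0

theorem add_self_eq_zero_of_zmod_two {ι : Type*} (u : ι → ZMod 2) : u + u = 0 :=
  funext fun i => CharTwo.add_self_eq_zero (u i)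

theorem cast_hamWt {n : ℕ} (v : Fin n → ZMod 2) : (hamWt v : ZMod 2) = ∑ c, v c := by
  rw [hamWt_eq_sum, Nat.cast_sum]
  refine Finset.sum_congr rfl fun c _ => ?_
  generalize v c = a
  revert a
  decide

theorem pairSwap_evenIdx {n : ℕ} (k : Fin (2 ^ n)) : pairSwap n (evenIdx k) = oddIdx k := by
  simp [pairSwap, evenIdx, oddIdx]

theorem pairSwap_oddIdx {n : ℕ} (k : Fin (2 ^ n)) : pairSwap n (oddIdx k) = evenIdx k := by
  simp [pairSwap, evenIdx, oddIdx, Nat.add_mod]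

theorem pairSwap_involutive (n : ℕ) : Function.Involutive (pairSwap n) := by
  intro c
  obtain ⟨k, rfl | rfl⟩ := exists_eq_evenIdx_or_oddIdx c
  · rw [pairSwap_evenIdx, pairSwap_oddIdx]
  · rw [pairSwap_oddIdx, pairSwap_evenIdx]

theorem Hmat_oddIdx (n : ℕ) (r k : Fin (2 ^ n)) :
    Hmat n r (oddIdx k) = if k = r then 1 else 0 := by
  cases n with
  | zero =>
    have : k = r := Subsingleton.elim (α := Fin 1) k r
    simp [Hmat, this]
  | succ n => simp [Hmat, oddIdx, Fin.ext_iff, Nat.add_mod]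

theorem Hmat_succ_evenIdx_evenIdx (n : ℕ) (r : Fin (2 ^ n)) (c : Fin (2 ^ (n + 1))) :
    Hmat (n + 1) (evenIdx r) (evenIdx c) = Hmat n r c := by
  simp [Hmat, evenIdx]

theorem Hmat_succ_oddIdx_evenIdx (n : ℕ) (r : Fin (2 ^ n)) (c : Fin (2 ^ (n + 1))) :
    Hmat (n + 1) (oddIdx r) (evenIdx c) = Hmat n r (pairSwap n c) := by
  have h : (2 * r.val + 1) / 2 = r.val := by omega
  simp [Hmat, evenIdx, oddIdx, Nat.add_mod, h]

theorem oddPart_vecMul_Hmat (n : ℕ) (u : Fin (2 ^ n) → ZMod 2) :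
    oddPart (Matrix.vecMul u (Hmat n)) = u := by
  funext k
  simp [oddPart, Matrix.vecMul, dotProduct, Hmat_oddIdx]

theorem hamWt_vecMul_Hmat (n : ℕ) (u : Fin (2 ^ n) → ZMod 2) :
    hamWt (Matrix.vecMul u (Hmat n)) = hamWt (evenColMap n u) + hamWt u := by
  rw [hamWt_eq_evenPart_add_oddPart, oddPart_vecMul_Hmat, evenColMap]

theorem evenColMap_add (n : ℕ) (u v : Fin (2 ^ n) → ZMod 2) :
    evenColMap n (u + v) = evenColMap n u + evenColMap n v := by
  simp only [evenColMap, Matrix.add_vecMul]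
  rfl

theorem evenColMap_zero_vec (n : ℕ) : evenColMap n 0 = 0 := by
  simp only [evenColMap, Matrix.zero_vecMul]
  rfl

theorem evenColMap_zero (u : Fin (2 ^ 0) → ZMod 2) : evenColMap 0 u = u := by
  funext k
  have h (i : Fin (2 ^ 0)) : i = k := Subsingleton.elim (α := Fin 1) i k
  simp [evenColMap, evenPart, Matrix.vecMul, dotProduct, Hmat, h 0]

theorem evenColMap_succ_apply (n : ℕ) (u : Fin (2 ^ (n + 1)) → ZMod 2)
    (c : Fin (2 ^ (n + 1))) :
    evenColMap (n + 1) u c = Matrix.vecMul (evenPart u) (Hmat n) c +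
      Matrix.vecMul (oddPart u) (Hmat n) (pairSwap n c) := by
  simp only [evenColMap, evenPart, oddPart, Matrix.vecMul, dotProduct,
    sum_evenIdx_add_sum_oddIdx (n := n), Hmat_succ_evenIdx_evenIdx, Hmat_succ_oddIdx_evenIdx]

theorem evenPart_evenColMap_succ (n : ℕ) (u : Fin (2 ^ (n + 1)) → ZMod 2) :
    evenPart (evenColMap (n + 1) u) = evenColMap n (evenPart u) + oddPart u := by
  funext k
  rw [evenPart, evenColMap_succ_apply, pairSwap_evenIdx]
  exact congrArg _ (congrFun (oddPart_vecMul_Hmat n (oddPart u)) k)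

theorem oddPart_evenColMap_succ (n : ℕ) (u : Fin (2 ^ (n + 1)) → ZMod 2) :
    oddPart (evenColMap (n + 1) u) = evenPart u + evenColMap n (oddPart u) := by
  funext k
  rw [oddPart, evenColMap_succ_apply, pairSwap_oddIdx]
  exact congrArg (· + _) (congrFun (oddPart_vecMul_Hmat n (evenPart u)) k)

theorem evenColMap_evenColMap (n : ℕ) (u : Fin (2 ^ n) → ZMod 2) :
    evenColMap n (evenColMap n u) = if Even n then u else 0 := by
  induction n with
  | zero => simp [evenColMap_zero]
  | succ n ih =>
    apply ext_evenPart_oddPart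
    · rw [evenPart_evenColMap_succ, evenPart_evenColMap_succ, oddPart_evenColMap_succ,
        evenColMap_add, ih]
      funext k
      by_cases h : Even n <;> simp [h, Nat.even_add_one, evenPart] <;> grind
    · rw [oddPart_evenColMap_succ, evenPart_evenColMap_succ, oddPart_evenColMap_succ,
        evenColMap_add, ih]
      funext k
      by_cases h : Even n <;> simp [h, Nat.even_add_one, oddPart] <;> grind

theorem sum_evenColMap (n : ℕ) (u : Fin (2 ^ n) → ZMod 2) :
    ∑ k, evenColMap n u k = (n + 1) * ∑ k, u k := by
  induction n with
  | zero => simp [evenColMap_zero]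
  | succ n ih =>
    have he := ih (evenPart u)
    have ho := ih (oddPart u)
    have h1 (k) := congrFun (evenPart_evenColMap_succ n u) k
    have h2 (k) := congrFun (oddPart_evenColMap_succ n u) k
    rw [sum_evenIdx_add_sum_oddIdx, sum_evenIdx_add_sum_oddIdx u]
    change ∑ k, evenPart (evenColMap (n + 1) u) k + ∑ k, oddPart (evenColMap (n + 1) u) k =
      _ * (∑ k, evenPart u k + ∑ k, oddPart u k)
    simp only [h1, h2, Pi.add_apply, Finset.sum_add_distrib, he, ho]
    push_cast
    ring

theorem even_hamWt_add_hamWt_evenColMap {n : ℕ} (hn : Even n) (u : Fin (2 ^ n) → ZMod 2) :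
    Even (hamWt u + hamWt (evenColMap n u)) := by
  rw [← ZMod.natCast_eq_zero_iff_even, Nat.cast_add, cast_hamWt, cast_hamWt, sum_evenColMap,
    (ZMod.natCast_eq_zero_iff_even).mpr hn, zero_add, one_mul, CharTwo.add_self_eq_zero]

theorem le_hamWt_add_hamWt_evenColMap (n : ℕ) (u : Fin (2 ^ n) → ZMod 2) (hu : u ≠ 0) :
    (if Even n then n + 2 else n + 1) ≤ hamWt u + hamWt (evenColMap n u) := by
  induction n with
  | zero =>
    have := hamWt_pos hu
    simp only [evenColMap_zero, Even.zero, if_true]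
    omega
  | succ n ih =>
    have key := even_hamWt_add_hamWt_evenColMap (n := n + 1) (u := u)
    have htot : hamWt u + hamWt (evenColMap (n + 1) u) =
        hamWt (evenPart u) + hamWt (oddPart u) +
        (hamWt (evenColMap n (evenPart u) + oddPart u) +
          hamWt (evenPart u + evenColMap n (oddPart u))) := by
      rw [hamWt_eq_evenPart_add_oddPart u, hamWt_eq_evenPart_add_oddPart (evenColMap _ _),
        evenPart_evenColMap_succ, oddPart_evenColMap_succ]
    have hne : ¬ (evenPart u = 0 ∧ oddPart u = 0) := fun h =>
      hu (ext_evenPart_oddPart h.1 h.2)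
    rw [htot] at key ⊢
    have hAA := evenColMap_evenColMap n
    clear htot hu
    generalize evenPart u = a at *
    generalize oddPart u = b at *
    by_cases hn : Even n
    · simp only [hn, if_true, Nat.even_add_one, not_true_eq_false, if_false] at ih hAA ⊢
      by_cases hc : evenColMap n a + b = 0
      · have hb : b = evenColMap n a := by
          rw [← add_zero (evenColMap n a), ← add_self_eq_zero_of_zmod_two b, ← add_assoc, hc,
            zero_add]
        have ha : a ≠ 0 := by
          rintro rfl
          exact hne ⟨rfl, by rw [hb, evenColMap_zero_vec]⟩
        have := ih a ha
        rw [← hb] at this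
        omega
      · have := ih _ hc
        rw [evenColMap_add, hAA] at this
        omega
    · simp only [hn, if_false, Nat.even_add_one, not_false_eq_true, if_true] at ih hAA key ⊢
      have hlt : n + 2 ≤ hamWt a + hamWt b +
          (hamWt (evenColMap n a + b) + hamWt (a + evenColMap n b)) := by
        by_cases ha : a = 0
        · subst ha
          have hb : b ≠ 0 := fun h => hne ⟨rfl, h⟩
          have h1 := ih b hb
          have h2 := hamWt_pos hb
          simp only [evenColMap_zero_vec, zero_add, hamWt_zero]
          omega
        · by_cases hd : a + evenColMap n b = 0
          · have hab : a = evenColMap n b := by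
              rw [← add_zero a, ← add_self_eq_zero_of_zmod_two (evenColMap n b), ← add_assoc, hd,
                zero_add]
            have hb : b ≠ 0 := by
              rintro rfl
              exact ha (by rw [hab, evenColMap_zero_vec])
            have h1 := ih b hb
            have h2 := hamWt_pos hb
            rw [hd, hab, hAA, zero_add]
            omega
          · have h1 := ih a ha
            have h2 := hamWt_pos hd
            have h3 := hamWt_add_le (evenColMap n a + b) b
            rw [add_assoc, add_self_eq_zero_of_zmod_two, add_zero] at h3
            omega
      obtain ⟨m, hm⟩ := key trivial
      obtain ⟨l, hl⟩ := Nat.not_even_iff_odd.mp hn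
      omega

theorem exists_hamWt_eq_one_hamWt_evenColMap (n : ℕ) :
    ∃ u : Fin (2 ^ n) → ZMod 2, hamWt u = 1 ∧ hamWt (evenColMap n u) = n + 1 := by
  refine ⟨fun i => if i.val = 0 then 1 else 0, ?_⟩
  induction n with
  | zero =>
    rw [evenColMap_zero, and_self]
    decide
  | succ n ih =>
    set e : Fin (2 ^ (n + 1)) → ZMod 2 := fun i => if i.val = 0 then 1 else 0 with he
    have h1 : evenPart e = fun i : Fin (2 ^ n) => if i.val = 0 then 1 else 0 := by
      funext k
      simp [he, evenPart, evenIdx]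
    have h2 : oddPart e = 0 := by
      funext k
      simp [he, oddPart, oddIdx]
    rw [hamWt_eq_evenPart_add_oddPart e, hamWt_eq_evenPart_add_oddPart (evenColMap _ _),
      evenPart_evenColMap_succ, oddPart_evenColMap_succ, h1, h2, evenColMap_zero_vec, add_zero,
      add_zero, hamWt_zero, ih.1, ih.2]
    exact ⟨rfl, rfl⟩

theorem exists_hamWt_add_hamWt_evenColMap_eq (n : ℕ) :
    ∃ u : Fin (2 ^ n) → ZMod 2, u ≠ 0 ∧
      hamWt u + hamWt (evenColMap n u) = if Even n then n + 2 else n + 1 := by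
  obtain ⟨u, h1, h2⟩ := exists_hamWt_eq_one_hamWt_evenColMap n
  by_cases hn : Even n
  · refine ⟨u, ?_, ?_⟩
    · rintro rfl
      simp [hamWt_zero] at h1
    · rw [if_pos hn, h1, h2]
      omega
  · refine ⟨evenColMap n u, ?_, ?_⟩
    · intro h
      simp [h, hamWt_zero] at h2
    · rw [evenColMap_evenColMap, if_neg hn, if_neg hn, h2, hamWt_zero]

theorem vecMul_indicator {m n : ℕ} (M : Matrix (Fin m) (Fin n) (ZMod 2)) (S : Finset (Fin m)) :
    Matrix.vecMul (fun i => if i ∈ S then 1 else 0) M = fun c => ∑ i ∈ S, M i c := by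
  funext c
  simp [Matrix.vecMul, dotProduct]

/-- For every `L ≥ 1` (paper index, so `Hmat (L-1)` is the paper's `H_L`),
the minimum over nonempty subsets `S` of the row indices of the Hamming weight of
`∑_{i ∈ S} x_i`, where `x_i` is row `i` of `H_L` if `L` is odd and row `i` of `H_L`
with coordinates permuted by `P_L` if `L` is even, equals `L + 1` if `L` is odd
and `L` if `L` is even. -/
theorem min_weight_logical_X (L : ℕ) (hL : 1 ≤ L) :
    let x : Fin (2 ^ (L - 1)) → (Fin (2 ^ (L - 1 + 1)) → ZMod 2) :=
      fun i c => if Odd L then Hmat (L - 1) i c else Hmat (L - 1) i (pairSwap (L - 1) c)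
    IsLeast {w : ℕ | ∃ S : Finset (Fin (2 ^ (L - 1))), S.Nonempty ∧
        w = hamWt (fun c => ∑ i ∈ S, x i c)}
      (if Odd L then L + 1 else L) := by
  obtain ⟨n, rfl⟩ : ∃ n, L = n + 1 := ⟨L - 1, by omega⟩
  intro x
  have hmin : (if Odd (n + 1) then n + 1 + 1 else n + 1) = if Even n then n + 2 else n + 1 := by
    simp [Nat.odd_add_one, Nat.not_odd_iff_even]
  have hx (S : Finset (Fin (2 ^ n))) : hamWt (fun c => ∑ i ∈ S, x i c) =
      hamWt (fun i => if i ∈ S then 1 else 0) +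
        hamWt (evenColMap n fun i => if i ∈ S then 1 else 0) := by
    refine Eq.trans ?_ ((hamWt_vecMul_Hmat n _).trans (add_comm _ _))
    rw [vecMul_indicator]
    by_cases h : Odd (n + 1)
    · simp only [x, if_pos h]
      rfl
    · simp only [x, if_neg h]
      exact hamWt_comp_equiv (pairSwap_involutive n).toPerm fun c => ∑ i ∈ S, Hmat n i c
  rw [hmin]
  constructor
  · obtain ⟨u, hu, hw⟩ := exists_hamWt_add_hamWt_evenColMap_eq n
    obtain ⟨c, hc⟩ := Function.ne_iff.mp hu
    obtain ⟨S, hS⟩ : ∃ S : Finset (Fin (2 ^ n)), ∀ i, i ∈ S ↔ u i ≠ 0 :=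
      ⟨Finset.univ.filter fun i => u i ≠ 0, by simp⟩
    have hind : (fun i => if i ∈ S then 1 else 0) = u := by
      funext i
      simp only [hS]
      generalize u i = a
      revert a
      decide
    refine ⟨S, ⟨c, (hS c).mpr hc⟩, ?_⟩
    rw [← hw, ← hind]
    exact (hx S).symm
  · rintro w ⟨S, ⟨i, hi⟩, rfl⟩
    refine (le_hamWt_add_hamWt_evenColMap n _ ?_).trans_eq (hx S).symm
    exact Function.ne_iff.mpr ⟨i, by simp [hi]⟩
end

section
/- For every L ≥ 1 and all row indices i, j ∈ {1,…,2^{L−1}}, there exist a permutation σ of the column set {1,…,2^L} and a permutation τ of the row set {1,…,2^{L−1}} with τ(i) = j such that H_L(τ(r), σ(c)) = H_L(r, c) for every row r and column c. That is, exchanging the stabilizers S_i and S_j of the Z-TGRE code can be realized by a permutation of the index numbers of the qubits that maps the set of rows of H_L onto itself. -/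
/-- The entries of `Hmat`, extended to all natural-number indices. -/
def entry : ℕ → ℕ → ℕ → ZMod 2
  | 0, _, _ => 1
  | L + 1, r, c =>
    if c % 2 = 1 then (if c = 2 * r + 1 then 1 else 0)
    else entry L (r / 2) (c / 2 ^^^ r % 2)

lemma val_pairSwap (M : ℕ) (c : Fin (2 ^ (M + 1))) : (pairSwap M c).val = c.val ^^^ 1 := by
  have hd : (c.val ^^^ 1) / 2 = c.val / 2 := by simp [Nat.xor_div_two]
  have hm : (c.val ^^^ 1) % 2 = (c.val + 1) % 2 := by simp [Nat.xor_mod_two_eq]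
  unfold pairSwap
  split <;> dsimp only <;> omega

lemma Hmat_apply (L : ℕ) (r : Fin (2 ^ L)) (c : Fin (2 ^ (L + 1))) :
    Hmat L r c = entry L r.val c.val := by
  induction L with
  | zero => rfl
  | succ L ih =>
    rcases Nat.mod_two_eq_zero_or_one r.val with h | h <;>
      simp [Hmat, entry, ih, val_pairSwap, h]

lemma xor_mod_two_self (a : ℕ) : a ^^^ a % 2 = 2 * (a / 2) := by
  have hd : (a ^^^ a % 2) / 2 = a / 2 := by simp [Nat.xor_div_two]
  have hm : (a ^^^ a % 2) % 2 = (a + a % 2) % 2 := by simp [Nat.xor_mod_two_eq]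
  omega

lemma entry_xor (L r c a : ℕ) : entry L (r ^^^ a) (c ^^^ 2 * a) = entry L r c := by
  induction L generalizing r c a with
  | zero => rfl
  | succ L ih =>
    have hm : (c ^^^ 2 * a) % 2 = c % 2 := by simp [Nat.xor_mod_two_eq]
    have hd : (c ^^^ 2 * a) / 2 = c / 2 ^^^ a := by simp [Nat.xor_div_two]
    have hrow : (r ^^^ a) % 2 = r % 2 ^^^ a % 2 := Nat.xor_mod_two_pow (n := 1)
    have hcol : c / 2 ^^^ a ^^^ (r % 2 ^^^ a % 2) = c / 2 ^^^ r % 2 ^^^ 2 * (a / 2) := by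
      rw [← xor_mod_two_self a]
      ac_rfl
    simp only [entry, hm, hd, hrow, hcol, Nat.xor_div_two, ih]
    split_ifs with h h₁ h₂ h₂
    · rfl
    · have : c / 2 = r := Nat.xor_left_inj.1 (show c / 2 ^^^ a = r ^^^ a by omega)
      omega
    · have : c / 2 ^^^ a = r ^^^ a := by congr 1; omega
      omega
    · rfl
    · rfl

/-- Translation of `Fin (2 ^ n)` by `a` for bitwise exclusive or. -/
def xorPerm (n a : ℕ) (ha : a < 2 ^ n) : Equiv.Perm (Fin (2 ^ n)) :=
  Function.Involutive.toPerm (fun x => ⟨x.val ^^^ a, Nat.xor_lt_two_pow x.isLt ha⟩)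
    fun x => by simp

lemma val_xorPerm (n a : ℕ) (ha : a < 2 ^ n) (x : Fin (2 ^ n)) :
    (xorPerm n a ha x).val = x.val ^^^ a := rfl

/-- For every `L ≥ 1` (paper index, `Hmat (L-1)` is the paper's `H_L`)
and all row indices `i, j`, there are a permutation `σ` of the columns (qubits) and a
permutation `τ` of the rows with `τ i = j` such that `H_L (τ r) (σ c) = H_L r c`
for all `r, c`; i.e. exchanging stabilizers `S_i` and `S_j` is realized by a
permutation of the qubit index numbers mapping the set of rows of `H_L` onto itself. -/
theorem row_exchange_by_qubit_permutation (L : ℕ) (hL : 1 ≤ L)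
    (i j : Fin (2 ^ (L - 1))) :
    ∃ (σ : Equiv.Perm (Fin (2 ^ (L - 1 + 1)))) (τ : Equiv.Perm (Fin (2 ^ (L - 1)))),
      τ i = j ∧ ∀ (r : Fin (2 ^ (L - 1))) (c : Fin (2 ^ (L - 1 + 1))),
        Hmat (L - 1) (τ r) (σ c) = Hmat (L - 1) r c := by
  have ha : i.val ^^^ j.val < 2 ^ (L - 1) := Nat.xor_lt_two_pow i.isLt j.isLt
  refine ⟨xorPerm _ (2 * (i.val ^^^ j.val)) (by rw [pow_succ]; omega), xorPerm _ _ ha, ?_, ?_⟩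
  · ext
    simp [val_xorPerm]
  · intro r c
    simp only [Hmat_apply, val_xorPerm, entry_xor]
end

section
/- For every even L ≥ 2, and for all row indices i, k ∈ {1,…,2^{L−1}}, the support of row k of H_L and the support of row i of H_L with coordinates permuted by P_L intersect in an even number of columns; equivalently, H_L · P · H_Lᵀ = 0 over GF(2), where P is the 2^L × 2^L permutation matrix of P_L. Consequently, when L is even, every logical X operator X̄_i of the Z-TGRE code (whose support is P_L applied to row i of H_L) commutes with every stabilizer generator S_k. -/
/-- The first (0-indexed: even) column of the `j`-th pair of columns. -/
def evenCol {M : ℕ} (j : Fin (2 ^ M)) : Fin (2 ^ (M + 1)) :=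
  ⟨2 * j.val, by have := j.isLt; rw [pow_succ]; omega⟩

/-- The second (0-indexed: odd) column of the `j`-th pair of columns. -/
def oddCol {M : ℕ} (j : Fin (2 ^ M)) : Fin (2 ^ (M + 1)) :=
  ⟨2 * j.val + 1, by have := j.isLt; rw [pow_succ]; omega⟩

/-- The index of the pair of columns that contains the column `c`. -/
def colPair {M : ℕ} (c : Fin (2 ^ (M + 1))) : Fin (2 ^ M) :=
  ⟨c.val / 2, by have := c.isLt; have := pow_succ 2 M; omega⟩

theorem eq_evenCol_or_eq_oddCol {M : ℕ} (c : Fin (2 ^ (M + 1))) :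
    c = evenCol (colPair c) ∨ c = oddCol (colPair c) := by
  simp only [evenCol, oddCol, colPair, Fin.ext_iff]
  omega

@[simp]
theorem pairSwap_evenCol {M : ℕ} (j : Fin (2 ^ M)) : pairSwap M (evenCol j) = oddCol j := by
  simp [pairSwap, evenCol, oddCol]

@[simp]
theorem pairSwap_oddCol {M : ℕ} (j : Fin (2 ^ M)) : pairSwap M (oddCol j) = evenCol j := by
  simp [pairSwap, evenCol, oddCol, Nat.add_mod]

theorem sum_eq_sum_evenCol_add_oddCol {R : Type*} [AddCommMonoid R] {M : ℕ}
    (f : Fin (2 ^ (M + 1)) → R) :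
    ∑ c, f c = ∑ j : Fin (2 ^ M), (f (evenCol j) + f (oddCol j)) := by
  rw [← ((finProdFinEquiv (m := 2 ^ M) (n := 2)).trans (finCongr (pow_succ 2 M).symm)).sum_comp f,
    Fintype.sum_prod_type]
  refine Finset.sum_congr rfl fun j _ => ?_
  rw [Fin.sum_univ_two]
  congr 2 <;> simp [finProdFinEquiv, evenCol, oddCol, Nat.add_comm]

theorem Hmat_oddCol (M : ℕ) (r j : Fin (2 ^ M)) :
    Hmat M r (oddCol j) = if j = r then 1 else 0 := by
  cases M with
  | zero => simp [Hmat, show j = r from Subsingleton.elim (α := Fin 1) j r]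
  | succ M => simp [Hmat, oddCol, Nat.add_mod, Fin.ext_iff]

theorem Hmat_succ_evenCol_evenCol (M : ℕ) (a : Fin (2 ^ M)) (c : Fin (2 ^ (M + 1))) :
    Hmat (M + 1) (evenCol a) (evenCol c) = Hmat M a c := by
  simp [Hmat, evenCol]

theorem Hmat_succ_oddCol_evenCol (M : ℕ) (a : Fin (2 ^ M)) (c : Fin (2 ^ (M + 1))) :
    Hmat (M + 1) (oddCol a) (evenCol c) = Hmat M a (pairSwap M c) := by
  have h : (2 * a.val + 1) / 2 = a.val := by omega
  simp [Hmat, evenCol, oddCol, Nat.add_mod, h]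

/-- The submatrix of `Hmat M` on the first columns of the pairs is symmetric. -/
theorem Hmat_evenCol_symm (M : ℕ) (r s : Fin (2 ^ M)) :
    Hmat M r (evenCol s) = Hmat M s (evenCol r) := by
  induction M with
  | zero => rfl
  | succ M ih =>
    rcases eq_evenCol_or_eq_oddCol r with hr | hr <;>
    rcases eq_evenCol_or_eq_oddCol s with hs | hs <;>
    rw [hr, hs] <;>
    simp [Hmat_succ_evenCol_evenCol, Hmat_succ_oddCol_evenCol, Hmat_oddCol, ih (colPair r),
      eq_comm]

theorem sum_Hmat_mul_Hmat_pairSwap (M : ℕ) (i k : Fin (2 ^ M)) :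
    ∑ c, Hmat M k c * Hmat M i (pairSwap M c) = 0 := by
  rw [sum_eq_sum_evenCol_add_oddCol]
  simp [Hmat_oddCol, Finset.sum_add_distrib, Hmat_evenCol_symm M k i, CharTwo.add_self_eq_zero]

theorem natCast_card_filter_ne_zero_and {ι : Type*} [Fintype ι] (v w : ι → ZMod 2) :
    ((Finset.univ.filter fun c => v c ≠ 0 ∧ w c ≠ 0).card : ZMod 2) = ∑ c, v c * w c := by
  rw [Finset.natCast_card_filter]
  refine Finset.sum_congr rfl fun c _ => ?_
  generalize v c = a
  generalize w c = b
  revert a b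
  decide

/-- For every even `L ≥ 2` (paper index, `Hmat (L-1)` is the paper's `H_L`),
for all row indices `i, k`, the support of row `k` of `H_L` and the support of row `i` of
`H_L` with coordinates permuted by `P_L` intersect in an even number of columns;
equivalently `H_L ⬝ P ⬝ H_Lᵀ = 0` over GF(2), where `P` is the permutation matrix of `P_L`.
Hence for even `L` every logical X operator `X̄_i` (supported on `P_L` applied to row `i`)
commutes with every stabilizer generator `S_k`. -/
theorem even_L_permuted_rows_orthogonal (L : ℕ) (hL : 2 ≤ L) (heven : Even L) :
    let P : Matrix (Fin (2 ^ (L - 1 + 1))) (Fin (2 ^ (L - 1 + 1))) (ZMod 2) :=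
      Matrix.of fun c c' => if pairSwap (L - 1) c = c' then 1 else 0
    (∀ i k : Fin (2 ^ (L - 1)),
      Even ((Finset.univ.filter (fun c : Fin (2 ^ (L - 1 + 1)) =>
        Hmat (L - 1) k c ≠ 0 ∧ Hmat (L - 1) i (pairSwap (L - 1) c) ≠ 0)).card)) ∧
    Hmat (L - 1) * P * (Hmat (L - 1)).transpose = 0 := by
  intro P
  refine ⟨fun i k => ?_, ?_⟩
  · rw [← ZMod.natCast_eq_zero_iff_even, natCast_card_filter_ne_zero_and]
    exact sum_Hmat_mul_Hmat_pairSwap (L - 1) i k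
  · ext k i
    rw [Matrix.mul_assoc, Matrix.mul_apply, Matrix.zero_apply,
      ← sum_Hmat_mul_Hmat_pairSwap (L - 1) i k]
    simp [P, Matrix.mul_apply]
end
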